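/- arXiv:1008.5218 — 2 statements merged into one kernel-verified Lean document; each statement's English description precedes it below -/
import Mathlib

section
/- Let A and E be Hermitian n×n matrices and suppose that for every t ∈ [0,1], λ_i(t), the i-th smallest eigenvalue of A+tE, is simple with unit eigenvector x(t). Then λ_i(A+E) − λ_i(A) = ∫₀¹ x(t)^H E x(t) dt. -/
open Matrix

noncomputable def euclNorm {K : Type*} [RCLike K] {I : Type*} [Fintype I] (x : I → K) : ℝ :=
  Real.sqrt (∑ i, ‖x i‖ ^ 2)

noncomputable def specNorm {K : Type*} [RCLike K] {I J : Type*} [Fintype I] [Fintype J]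
    [DecidableEq J] (M : Matrix I J K) : ℝ :=
  ‖LinearMap.toContinuousLinearMap (Matrix.toEuclideanLin M)‖

noncomputable def ithEig {K : Type*} [RCLike K] {I : Type*} [Fintype I] [DecidableEq I]
    {A : Matrix I I K} (hA : A.IsHermitian) (i : Fin (Fintype.card I)) : ℝ :=
  (hA.eigenvalues ∘ (Fintype.equivFin I).symm)
    (Tuple.sort (hA.eigenvalues ∘ (Fintype.equivFin I).symm) i)

open Filter Topology

section Weyl

variable {K : Type*} [RCLike K] {V : Type*} [NormedAddCommGroup V] [InnerProductSpace K V]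

theorem re_inner_apply_eq_sum_of_eigenbasis {ι : Type*} [Fintype ι] (b : OrthonormalBasis ι K V)
    {S : V →ₗ[K] V} {μ : ι → ℝ} (hS : ∀ j, S (b j) = (μ j : K) • b j) (v : V) :
    RCLike.re (inner K v (S v)) = ∑ j, μ j * ‖inner K (b j) v‖ ^ 2 := by
  have hv : S v = ∑ j, (inner K (b j) v * (μ j : K)) • b j := by
    conv_lhs => rw [← b.sum_repr' v]
    simp [map_sum, hS, smul_smul]
  rw [hv, inner_sum, map_sum]
  refine Finset.sum_congr rfl fun j _ => ?_
  have : inner K v ((inner K (b j) v * (μ j : K)) • b j)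
      = ((μ j * ‖inner K (b j) v‖ ^ 2 : ℝ) : K) := by
    rw [inner_smul_right, ← inner_conj_symm v (b j)]
    push_cast
    rw [← RCLike.mul_conj]
    ring
  rw [this, RCLike.ofReal_re]

theorem inner_eq_zero_of_mem_span_subtype {ι : Type*} [Fintype ι] (b : OrthonormalBasis ι K V)
    {p : ι → Prop} {v : V} (hv : v ∈ Submodule.span K (Set.range fun j : {j // p j} => b j))
    {k : ι} (hk : ¬ p k) : inner K (b k) v = 0 := by
  suffices h : Submodule.span K (Set.range fun j : {j // p j} => b j)
      ≤ LinearMap.ker (innerSL K (b k)).toLinearMap by simpa using h hv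
  rw [Submodule.span_le]
  rintro _ ⟨j, rfl⟩
  have hne : k ≠ j := fun h => hk (h ▸ j.2)
  simpa using b.orthonormal.2 hne

/-- **Weyl's monotonicity principle** for operators diagonalised by orthonormal bases. -/
theorem eigenvalue_le_add_of_forall_re_inner_le {m : ℕ} (b b' : OrthonormalBasis (Fin m) K V)
    {S T : V →ₗ[K] V} {μ ν : Fin m → ℝ} (hμ : Monotone μ) (hν : Monotone ν)
    (hS : ∀ j, S (b j) = (μ j : K) • b j) (hT : ∀ j, T (b' j) = (ν j : K) • b' j) {c : ℝ}
    (h : ∀ v, RCLike.re (inner K v (S v)) ≤ RCLike.re (inner K v (T v)) + c * ‖v‖ ^ 2)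
    (i : Fin m) : μ i ≤ ν i + c := by
  obtain ⟨v, hv, hv', hv0⟩ : ∃ v ∈ Submodule.span K (Set.range fun j : {j // i ≤ j} => b j),
      v ∈ Submodule.span K (Set.range fun j : {j // j ≤ i} => b' j) ∧ v ≠ 0 := by
    have : FiniteDimensional K V := b.toBasis.finiteDimensional_of_finite
    by_contra! hcon
    have hdim := Submodule.finrank_add_finrank_le_of_disjoint (Submodule.disjoint_def.2 hcon)
    have hb : LinearIndependent K fun j : {j // i ≤ j} => b j :=
      b.orthonormal.linearIndependent.comp _ Subtype.val_injective
    have hb' : LinearIndependent K fun j : {j // j ≤ i} => b' j :=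
      b'.orthonormal.linearIndependent.comp _ Subtype.val_injective
    rw [finrank_span_eq_card hb, finrank_span_eq_card hb',
      Module.finrank_eq_card_basis b.toBasis, Fintype.card_subtype, Fintype.card_subtype,
      Finset.filter_le_eq_Ici, Finset.filter_ge_eq_Iic, Fin.card_Ici, Fin.card_Iic,
      Fintype.card_fin] at hdim
    omega
  have hlow : μ i * ‖v‖ ^ 2 ≤ RCLike.re (inner K v (S v)) := by
    rw [re_inner_apply_eq_sum_of_eigenbasis b hS, ← b.sum_sq_norm_inner_right v, Finset.mul_sum]
    refine Finset.sum_le_sum fun j _ => ?_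
    by_cases hj : i ≤ j
    · gcongr
      exact hμ hj
    · simp [inner_eq_zero_of_mem_span_subtype b hv hj]
  have hupp : RCLike.re (inner K v (T v)) ≤ ν i * ‖v‖ ^ 2 := by
    rw [re_inner_apply_eq_sum_of_eigenbasis b' hT, ← b'.sum_sq_norm_inner_right v, Finset.mul_sum]
    refine Finset.sum_le_sum fun j _ => ?_
    by_cases hj : j ≤ i
    · gcongr
      exact hν hj
    · simp [inner_eq_zero_of_mem_span_subtype b' hv' hj]
  have hpos : 0 < ‖v‖ ^ 2 := by positivity
  refine le_of_mul_le_mul_right ?_ hpos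
  linarith [h v]

end Weyl

section Eigenvalues

variable {K : Type*} [RCLike K] {I : Type*} [Fintype I] [DecidableEq I]

theorem monotone_ithEig {A : Matrix I I K} (hA : A.IsHermitian) : Monotone (ithEig hA) :=
  Tuple.monotone_sort (hA.eigenvalues ∘ (Fintype.equivFin I).symm)

theorem exists_orthonormalBasis_ithEig {A : Matrix I I K} (hA : A.IsHermitian) :
    ∃ b : OrthonormalBasis (Fin (Fintype.card I)) K (EuclideanSpace K I),
      ∀ j, toEuclideanLin A (b j) = (ithEig hA j : K) • b j := by
  let e := (Tuple.sort (hA.eigenvalues ∘ (Fintype.equivFin I).symm)).trans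
    (Fintype.equivFin I).symm
  refine ⟨hA.eigenvectorBasis.reindex e.symm, fun j => ?_⟩
  have h := hA.mulVec_eigenvectorBasis (e j)
  rw [RCLike.real_smul_eq_coe_smul (K := K)] at h
  rw [OrthonormalBasis.reindex_apply, Equiv.symm_symm, toLpLin_apply, h]
  rfl

theorem ithEig_congr {A B : Matrix I I K} (hA : A.IsHermitian) (hB : B.IsHermitian) (h : A = B)
    (i : Fin (Fintype.card I)) : ithEig hA i = ithEig hB i := by
  subst h; rfl

theorem ithEig_le_add_specNorm_sub {A B : Matrix I I K} (hA : A.IsHermitian)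
    (hB : B.IsHermitian) (i : Fin (Fintype.card I)) :
    ithEig hA i ≤ ithEig hB i + specNorm (A - B) := by
  obtain ⟨b, hb⟩ := exists_orthonormalBasis_ithEig hA
  obtain ⟨b', hb'⟩ := exists_orthonormalBasis_ithEig hB
  refine eigenvalue_le_add_of_forall_re_inner_le b b' (monotone_ithEig hA) (monotone_ithEig hB)
    hb hb' (fun v => ?_) i
  have hle : RCLike.re (inner K v (toEuclideanLin (A - B) v)) ≤ specNorm (A - B) * ‖v‖ ^ 2 :=
    calc _ ≤ ‖v‖ * ‖toEuclideanLin (A - B) v‖ := re_inner_le_norm _ _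
      _ ≤ ‖v‖ * (specNorm (A - B) * ‖v‖) := by
        gcongr
        exact (LinearMap.toContinuousLinearMap (toEuclideanLin (A - B))).le_opNorm v
      _ = _ := by ring
  rw [map_sub, LinearMap.sub_apply, inner_sub_right, map_sub] at hle
  linarith

theorem specNorm_real_smul (c : ℝ) (M : Matrix I I ℂ) : specNorm (c • M) = |c| * specNorm M := by
  have : c • M = (c : ℂ) • M := by ext; simp
  rw [this, specNorm, map_smul, map_smul, norm_smul, specNorm]
  simp

theorem continuous_ithEig_add_smul {A E : Matrix I I ℂ} (h : ∀ t : ℝ, (A + t • E).IsHermitian)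
    (i : Fin (Fintype.card I)) : Continuous fun t => ithEig (h t) i := by
  have key : ∀ s t : ℝ, ithEig (h s) i ≤ ithEig (h t) i + specNorm E * |s - t| := fun s t => by
    have := ithEig_le_add_specNorm_sub (h s) (h t) i
    rwa [add_sub_add_left_eq_sub, ← sub_smul, specNorm_real_smul, mul_comm] at this
  refine (LipschitzWith.of_dist_le' (K := specNorm E) fun s t => ?_).continuous
  rw [Real.dist_eq, Real.dist_eq, abs_le]
  have h₁ := key s t
  have h₂ := key t s
  rw [abs_sub_comm] at h₂
  constructor <;> linarith

end Eigenvalues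

section Projection

variable {I : Type*} [Fintype I]

theorem star_dotProduct_self_eq_euclNorm_sq (v : I → ℂ) :
    star v ⬝ᵥ v = ((euclNorm v ^ 2 : ℝ) : ℂ) := by
  rw [euclNorm, Real.sq_sqrt (by positivity), dotProduct]
  push_cast
  exact Finset.sum_congr rfl fun j _ => by simpa using Complex.conj_mul' (v j)

theorem norm_le_one_of_star_dotProduct_self {v : I → ℂ} (hv : star v ⬝ᵥ v = 1) (j : I) :
    ‖v j‖ ≤ 1 := by
  have h : ∑ k, ‖v k‖ ^ 2 = 1 := by
    have : ((∑ k, ‖v k‖ ^ 2 : ℝ) : ℂ) = 1 := by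
      rw [← hv, dotProduct]
      push_cast
      exact Finset.sum_congr rfl fun k _ => by simpa using (Complex.conj_mul' (v k)).symm
    exact_mod_cast this
  have hj : ‖v j‖ ^ 2 ≤ 1 :=
    h ▸ Finset.single_le_sum (f := fun k => ‖v k‖ ^ 2) (fun k _ => by positivity)
      (Finset.mem_univ j)
  exact (sq_le_one_iff₀ (norm_nonneg _)).1 hj

/-- A Hermitian matrix of trace one whose columns are multiples of a unit vector is the
orthogonal projection onto that vector. -/
theorem eq_vecMulVec_star_of_cols {Q : Matrix I I ℂ} (hQ : Q.IsHermitian) (htr : Q.trace = 1)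
    {v : I → ℂ} (hv : star v ⬝ᵥ v = 1) (hcol : ∀ j, ∃ c : ℂ, c • v = fun k => Q k j) :
    Q = vecMulVec v (star v) := by
  choose c hc using hcol
  have hQc : Q = vecMulVec v c := by
    ext k j
    have := congrFun (hc j) k
    simp only [Pi.smul_apply, smul_eq_mul] at this
    rw [vecMulVec_apply, ← this, mul_comm]
  have hcv : star c = (c ⬝ᵥ v) • v := by
    have h₁ : Qᴴ *ᵥ v = star c := by
      rw [hQc, conjTranspose_vecMulVec, vecMulVec_mulVec, hv]
      simp
    rw [← h₁, hQ.eq, hQc, vecMulVec_mulVec]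
    simp
  have htr' : c ⬝ᵥ v = 1 := by
    rw [dotProduct_comm, ← trace_vecMulVec, ← hQc, htr]
  rw [hQc, ← star_star c, hcv, htr', one_smul]

theorem exists_smul_eq_of_finrank_eigenspace_eq_one [DecidableEq I] {M : Matrix I I ℂ} {l : ℂ}
    (h : Module.finrank ℂ (Module.End.eigenspace (toEuclideanLin M) l) = 1)
    {v w : I → ℂ} (hv0 : v ≠ 0) (hv : M *ᵥ v = l • v) (hw : M *ᵥ w = l • w) :
    ∃ c : ℂ, c • v = w := by
  have mem : ∀ u : I → ℂ, M *ᵥ u = l • u →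
      WithLp.toLp 2 u ∈ Module.End.eigenspace (toEuclideanLin M) l := fun u hu => by
    rw [Module.End.mem_eigenspace_iff, toLpLin_apply, hu]
    rfl
  have hne : (⟨_, mem v hv⟩ : Module.End.eigenspace (toEuclideanLin M) l) ≠ 0 := fun h0 =>
    hv0 (congrArg (fun u => u.1.ofLp) h0)
  obtain ⟨c, hc⟩ := (finrank_eq_one_iff_of_nonzero' _ hne).1 h ⟨_, mem w hw⟩
  exact ⟨c, congrArg (fun u => u.1.ofLp) hc⟩

theorem continuousOn_vecMulVec_star_of_simple [DecidableEq I] {M : ℝ → Matrix I I ℂ} {l : ℝ → ℂ}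
    {s : Set ℝ} (hM : ContinuousOn M s) (hl : ContinuousOn l s) {x : ℝ → I → ℂ}
    (hx : ∀ t ∈ s, star (x t) ⬝ᵥ x t = 1) (heig : ∀ t ∈ s, M t *ᵥ x t = l t • x t)
    (hsimple : ∀ t ∈ s, Module.finrank ℂ (Module.End.eigenspace (toEuclideanLin (M t)) (l t)) = 1) :
    ContinuousOn (fun t => vecMulVec (x t) (star (x t))) s := by
  intro t ht
  have hK : IsCompact {Q : Matrix I I ℂ | ∀ j k, Q j k ∈ Metric.closedBall (0 : ℂ) 1} := by
    have hset : {Q : Matrix I I ℂ | ∀ j k, Q j k ∈ Metric.closedBall (0 : ℂ) 1}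
        = Set.univ.pi fun _ : I => Set.univ.pi fun _ : I => Metric.closedBall (0 : ℂ) 1 :=
      Set.ext fun _ => ⟨fun h j _ k _ => h j k, fun h j k => h j trivial k trivial⟩
    rw [hset]
    exact isCompact_univ_pi fun _ => isCompact_univ_pi fun _ => isCompact_closedBall _ _
  refine hK.tendsto_nhds_of_unique_mapClusterPt ?_ fun Q _ hQ => ?_
  · filter_upwards [self_mem_nhdsWithin] with r hr j k
    have hj := norm_le_one_of_star_dotProduct_self (hx r hr) j
    have hk := norm_le_one_of_star_dotProduct_self (hx r hr) k
    simpa [vecMulVec_apply] using mul_le_one₀ hj (norm_nonneg _) hk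
  · obtain ⟨U, hU, hlim⟩ := mapClusterPt_iff_ultrafilter.1 hQ
    have hmem : ∀ᶠ r in (U : Filter ℝ), r ∈ s := hU self_mem_nhdsWithin
    have hherm : Q.IsHermitian := by
      refine tendsto_nhds_unique (((continuous_id.matrix_conjTranspose).tendsto Q).comp hlim)
        (hlim.congr fun r => ?_)
      simp [conjTranspose_vecMulVec]
    have htr : Q.trace = 1 := by
      refine tendsto_nhds_unique (((continuous_id.matrix_trace).tendsto Q).comp hlim)
        (tendsto_const_nhds.congr' ?_)
      filter_upwards [hmem] with r hr
      simp only [Function.comp_apply, id, trace_vecMulVec]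
      rw [dotProduct_comm, hx r hr]
    have hMQ : M t * Q = l t • Q := by
      have h₁ := ((continuous_fst.matrix_mul continuous_snd).tendsto (M t, Q)).comp
        (((hM t ht).mono_left hU).prodMk_nhds hlim)
      refine tendsto_nhds_unique h₁ ((((hl t ht).mono_left hU).smul hlim).congr' ?_)
      filter_upwards [hmem] with r hr
      simp only [Function.comp_apply, mul_vecMulVec, heig r hr, smul_vecMulVec]
    refine eq_vecMulVec_star_of_cols hherm htr (hx t ht) fun j =>
      exists_smul_eq_of_finrank_eigenspace_eq_one (hsimple t ht) ?_ (heig t ht) ?_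
    · intro h0
      simpa [h0] using hx t ht
    · ext k
      simpa [mul_apply, mulVec, dotProduct] using congrFun (congrFun hMQ k) j

theorem trace_mul_vecMulVec_star (E : Matrix I I ℂ) (v : I → ℂ) :
    (E * vecMulVec v (star v)).trace = star v ⬝ᵥ E *ᵥ v := by
  rw [mul_vecMulVec, trace_vecMulVec, dotProduct_comm]

theorem sub_mul_trace_mul_eq {A E P Q : Matrix I I ℂ} {s t l m : ℝ}
    (hP : P * (A + s • E) = (l : ℂ) • P) (hQ : (A + t • E) * Q = (m : ℂ) • Q) :
    ((m - l : ℝ) : ℂ) * (P * Q).trace = ((t - s : ℝ) : ℂ) * (P * E * Q).trace := by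
  have h₁ : P * (A + t • E) * Q = (m : ℂ) • (P * Q) := by rw [Matrix.mul_assoc, hQ, Matrix.mul_smul]
  have h₂ : P * (A + s • E) * Q = (l : ℂ) • (P * Q) := by rw [hP, Matrix.smul_mul]
  have h₃ : P * (A + t • E) * Q - P * (A + s • E) * Q = ((t - s : ℝ) : ℂ) • (P * E * Q) := by
    rw [← Matrix.sub_mul, ← Matrix.mul_sub, add_sub_add_left_eq_sub, ← sub_smul,
      ← Complex.coe_smul, Matrix.mul_smul, Matrix.smul_mul]
  rw [h₁, h₂, ← sub_smul] at h₃
  simpa [trace_smul] using congrArg trace h₃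

/-- First-order perturbation theory: the derivative of a simple eigenvalue `l t` of `A + tE`,
given continuity of the associated spectral projection. -/
theorem hasDerivWithinAt_eigenvalue {A E : Matrix I I ℂ} {l : ℝ → ℝ} {s : Set ℝ}
    {x : ℝ → I → ℂ} (hherm : ∀ t ∈ s, (A + t • E).IsHermitian)
    (hx : ∀ t ∈ s, star (x t) ⬝ᵥ x t = 1)
    (heig : ∀ t ∈ s, (A + t • E) *ᵥ x t = (l t : ℂ) • x t)
    (hcont : ContinuousOn (fun t => vecMulVec (x t) (star (x t))) s) {t : ℝ} (ht : t ∈ s) :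
    HasDerivWithinAt l (star (x t) ⬝ᵥ E *ᵥ x t).re s t := by
  set P : ℝ → Matrix I I ℂ := fun r => vecMulVec (x r) (star (x r)) with hPdef
  have hPP : P t * P t = P t := by
    rw [hPdef, vecMulVec_mul_vecMulVec, hx t ht, one_smul]
  have htrP : (P t).trace = 1 := by rw [hPdef, trace_vecMulVec, dotProduct_comm, hx t ht]
  have hright : ∀ r ∈ s, (A + r • E) * P r = (l r : ℂ) • P r := fun r hr => by
    simp only [hPdef, mul_vecMulVec, heig r hr, smul_vecMulVec]
  have hleft : ∀ r ∈ s, P r * (A + r • E) = (l r : ℂ) • P r := fun r hr => by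
    have := congrArg conjTranspose (hright r hr)
    rw [conjTranspose_mul, (hherm r hr).eq, conjTranspose_smul] at this
    simpa [hPdef, conjTranspose_vecMulVec] using this
  have hnum : Tendsto (fun r => (P t * E * P r).trace) (𝓝[s] t) (𝓝 (star (x t) ⬝ᵥ E *ᵥ x t)) := by
    have : (P t * E * P t).trace = star (x t) ⬝ᵥ E *ᵥ x t := by
      rw [trace_mul_cycle, hPP, trace_mul_comm, trace_mul_vecMulVec_star]
    rw [← this]
    exact (((continuous_const.matrix_mul continuous_id).matrix_trace).tendsto (P t)).comp
      (hcont t ht)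
  have hden : Tendsto (fun r => (P t * P r).trace) (𝓝[s] t) (𝓝 1) := by
    have : (P t * P t).trace = 1 := by rw [hPP, htrP]
    rw [← this]
    exact (((continuous_const.matrix_mul continuous_id).matrix_trace).tendsto (P t)).comp
      (hcont t ht)
  rw [hasDerivWithinAt_iff_tendsto_slope]
  have hquot := (hnum.div hden one_ne_zero).mono_left (nhdsWithin_mono t (Set.sdiff_subset (t := {t})))
  rw [div_one] at hquot
  refine ((Complex.continuous_re.tendsto _).comp hquot).congr' ?_
  have hne := (hden.mono_left (nhdsWithin_mono t (Set.sdiff_subset (t := {t})))).eventually_ne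
    one_ne_zero
  filter_upwards [hne, self_mem_nhdsWithin] with r hr hrs
  have hrt : r - t ≠ 0 := sub_ne_zero.2 hrs.2
  have hmain := sub_mul_trace_mul_eq (hleft t ht) (hright r hrs.1)
  have hrt' : ((r - t : ℝ) : ℂ) ≠ 0 := Complex.ofReal_ne_zero.2 hrt
  have : (P t * E * P r).trace / (P t * P r).trace = ((slope l t r : ℝ) : ℂ) := by
    rw [slope_def_field, Complex.ofReal_div, div_eq_div_iff hr hrt', hmain]
    ring
  simp [this]

end Projection

/-- Integral representation of the eigenvalue perturbation: if the i-th
smallest eigenvalue of `A + tE` is simple for all `t ∈ [0,1]` with unit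
eigenvector `x t`, then `λ_i(A+E) − λ_i(A) = ∫₀¹ x(t)ᴴ E x(t) dt`. -/
theorem stmt_8 {n : ℕ} (A E : Matrix (Fin n) (Fin n) ℂ)
    (hA : A.IsHermitian) (hE : E.IsHermitian) (hAE : (A + E).IsHermitian)
    (htE : ∀ t : ℝ, (A + t • E).IsHermitian)
    (i : Fin (Fintype.card (Fin n)))
    (x : ℝ → (Fin n → ℂ))
    (heig : ∀ t ∈ Set.Icc (0:ℝ) 1,
      (A + t • E).mulVec (x t) = ((ithEig (htE t) i : ℝ) : ℂ) • x t)
    (hunit : ∀ t ∈ Set.Icc (0:ℝ) 1, euclNorm (x t) = 1)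
    (hsimple : ∀ t ∈ Set.Icc (0:ℝ) 1,
      Module.finrank ℂ (Module.End.eigenspace (Matrix.toEuclideanLin (A + t • E))
        ((ithEig (htE t) i : ℝ) : ℂ)) = 1) :
    ithEig hAE i - ithEig hA i = ∫ t in (0:ℝ)..1, (star (x t) ⬝ᵥ E.mulVec (x t)).re := by
  have hx : ∀ t ∈ Set.Icc (0 : ℝ) 1, star (x t) ⬝ᵥ x t = 1 := fun t ht => by
    rw [star_dotProduct_self_eq_euclNorm_sq, hunit t ht]
    simp
  have hcont := continuous_ithEig_add_smul htE i
  have hP : ContinuousOn (fun t => vecMulVec (x t) (star (x t))) (Set.Icc (0 : ℝ) 1) :=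
    continuousOn_vecMulVec_star_of_simple (M := fun t : ℝ => A + t • E)
      (l := fun t => (ithEig (htE t) i : ℂ)) (by fun_prop)
      (Complex.continuous_ofReal.comp hcont).continuousOn hx heig hsimple
  have hint : ContinuousOn (fun t => (star (x t) ⬝ᵥ E *ᵥ x t).re) (Set.Icc (0 : ℝ) 1) := by
    simp_rw [← trace_mul_vecMulVec_star]
    exact (Complex.continuous_re.comp
      (continuous_const.matrix_mul continuous_id).matrix_trace).comp_continuousOn hP
  have hder : ∀ t ∈ Set.Ioo (0 : ℝ) 1,
      HasDerivAt (fun r => ithEig (htE r) i) (star (x t) ⬝ᵥ E *ᵥ x t).re t := fun t ht =>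
    (hasDerivWithinAt_eigenvalue (fun r _ => htE r) hx heig hP
      (Set.Ioo_subset_Icc_self ht)).hasDerivAt (Icc_mem_nhds ht.1 ht.2)
  rw [intervalIntegral.integral_eq_sub_of_hasDerivAt_of_le zero_le_one hcont.continuousOn hder
    (ContinuousOn.intervalIntegrable_of_Icc zero_le_one hint),
    ithEig_congr hAE (htE 1) (by simp), ithEig_congr hA (htE 0) (by simp)]
end

section
/- Let A and E be Hermitian matrices partitioned conformally as A = [[A11, A21^H],[A21, A22]] and E = [[E11, E21^H],[E21, E22]] with second block of size k. Suppose λ_i(t), the i-th smallest eigenvalue of A+tE, is simple for all t ∈ [0,1] with unit eigenvector x(t) = [x1(t); x2(t)], x2(t) ∈ ℂ^k. Then |λ_i(A+E) − λ_i(A)| ≤ ∫₀¹ (‖E11‖₂‖x1(t)‖₂² + 2‖E21‖₂‖x1(t)‖₂‖x2(t)‖₂ + ‖E22‖₂‖x2(t)‖₂²) dt. -/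
open Matrix

open Filter Topology Set Polynomial in
theorem Monotone.eq_of_prod_sub_eq {n : ℕ} {f g : Fin n → ℝ} (hf : Monotone f) (hg : Monotone g)
    (h : ∀ z, ∏ j, (z - f j) = ∏ j, (z - g j)) : f = g := by
  have hpoly : ∏ j, (X - C (f j)) = ∏ j, (X - C (g j)) :=
    Polynomial.funext fun z => by simpa [eval_prod] using h z
  have hroots (u : Fin n → ℝ) : (∏ j, (X - C (u j))).roots = Multiset.ofList (List.ofFn u) := by
    rw [← roots_multiset_prod_X_sub_C (Multiset.ofList (List.ofFn u))]
    simp [List.prod_ofFn, Function.comp_def]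
  exact List.ofFn_injective <| (Multiset.coe_eq_coe.mp <| by
    rw [← hroots f, hpoly, hroots g]).eq_of_sortedLE hf.sortedLE_ofFn hg.sortedLE_ofFn

theorem ithEig_monotone {I : Type*} [Fintype I] [DecidableEq I] {M : Matrix I I ℂ}
    (hM : M.IsHermitian) : Monotone (ithEig hM) :=
  Tuple.monotone_sort (hM.eigenvalues ∘ (Fintype.equivFin I).symm)

theorem prod_sub_ithEig {I : Type*} [Fintype I] [DecidableEq I] {M : Matrix I I ℂ}
    (hM : M.IsHermitian) (z : ℝ) :
    ((∏ j, (z - ithEig hM j) : ℝ) : ℂ) = (Matrix.scalar I (z : ℂ) - M).det := by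
  rw [← Matrix.eval_charpoly, hM.charpoly_eq, Polynomial.eval_prod]
  push_cast
  simp only [Polynomial.eval_sub, Polynomial.eval_X, Polynomial.eval_C]
  exact Fintype.prod_equiv ((Tuple.sort (hM.eigenvalues ∘ (Fintype.equivFin I).symm)).trans
    (Fintype.equivFin I).symm) _ _ fun j => rfl

open scoped Matrix.Norms.L2Operator in
theorem abs_ithEig_le_l2_opNorm {I : Type*} [Fintype I] [DecidableEq I] {M : Matrix I I ℂ}
    (hM : M.IsHermitian) (i : Fin (Fintype.card I)) : |ithEig hM i| ≤ ‖M‖ := by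
  have h (j : I) : |hM.eigenvalues j| ≤ ‖M‖ := by
    have := Matrix.l2_opNorm_mulVec M (hM.eigenvectorBasis j)
    rw [hM.mulVec_eigenvectorBasis] at this
    simpa [norm_smul] using this
  exact h _

open scoped Matrix.Norms.L2Operator in
open Filter Topology in
theorem continuous_ithEig {X I : Type*} [TopologicalSpace X] [Fintype I] [DecidableEq I]
    {M : X → Matrix I I ℂ} (hM : ∀ s, (M s).IsHermitian) (hcont : Continuous M)
    (i : Fin (Fintype.card I)) : Continuous fun s => ithEig (hM s) i := by
  suffices h : Continuous fun s => ithEig (hM s) from (continuous_apply i).comp h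
  refine continuous_iff_continuousAt.mpr fun t => ?_
  refine (tendsto_iff_ultrafilter _ _ _).mpr fun U hU => ?_
  have hbound : ∀ᶠ s in (U : Filter X),
      ithEig (hM s) ∈ Set.Icc (fun _ => -(‖M t‖ + 1)) (fun _ => ‖M t‖ + 1) := by
    filter_upwards [hU ((hcont.norm.tendsto t).eventually_lt_const (lt_add_one _))] with s hs
    exact ⟨fun j => (abs_le.mp ((abs_ithEig_le_l2_opNorm _ j).trans hs.le)).1,
      fun j => (abs_le.mp ((abs_ithEig_le_l2_opNorm _ j).trans hs.le)).2⟩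
  obtain ⟨ρ, -, hρ⟩ := isCompact_Icc.ultrafilter_le_nhds
    (U.map fun s => ithEig (hM s)) (le_principal_iff.mpr hbound)
  replace hρ : Tendsto (fun s => ithEig (hM s)) U (𝓝 ρ) := hρ
  have hmono : Monotone ρ := fun a b hab =>
    le_of_tendsto_of_tendsto' ((continuous_apply a).tendsto ρ |>.comp hρ)
      ((continuous_apply b).tendsto ρ |>.comp hρ) fun s => ithEig_monotone (hM s) hab
  have heq : ρ = ithEig (hM t) := hmono.eq_of_prod_sub_eq (ithEig_monotone _) fun z => by
    have hcρ : Continuous fun u : Fin (Fintype.card I) → ℝ => ((∏ j, (z - u j) : ℝ) : ℂ) := by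
      fun_prop
    have hdet : Continuous fun s => (Matrix.scalar I (z : ℂ) - M s).det :=
      (continuous_const.sub hcont).matrix_det
    have h₁ := (hcρ.tendsto ρ).comp hρ
    simp only [Function.comp_def, prod_sub_ithEig] at h₁
    have h₂ := tendsto_nhds_unique h₁ ((hdet.tendsto t).mono_left hU)
    rw [← prod_sub_ithEig (hM t)] at h₂
    exact_mod_cast h₂
  rwa [heq] at hρ

open Filter Topology in
/-- Near a point where the eigenvalue is simple, phase-invariant continuous functions of a
normalized eigenvector are continuous, whatever phases are chosen. -/
theorem tendsto_comp_eigenvector_of_simple {X V : Type*} [TopologicalSpace X]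
    [NormedAddCommGroup V] [NormedSpace ℂ V] [FiniteDimensional ℂ V]
    {S : Set X} {t : X} (ht : t ∈ S) {T : X → V →L[ℂ] V} (hT : Continuous T)
    {μ : X → ℂ} (hμ : Continuous μ) {v : X → V} (heig : ∀ s ∈ S, T s (v s) = μ s • v s)
    (hv : ∀ s ∈ S, ‖v s‖ = 1)
    (hsimple : Module.finrank ℂ (Module.End.eigenspace (T t : V →ₗ[ℂ] V) (μ t)) = 1)
    {F : V → ℝ} (hF : Continuous F) (hphase : ∀ c : ℂ, ‖c‖ = 1 → F (c • v t) = F (v t)) :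
    Tendsto (fun s => F (v s)) (𝓝[S] t) (𝓝 (F (v t))) := by
  have : ProperSpace V := FiniteDimensional.proper ℂ V
  refine (tendsto_iff_ultrafilter _ _ _).mpr fun U hU => ?_
  have hUt : (U : Filter X) ≤ 𝓝 t := hU.trans nhdsWithin_le_nhds
  have hUS : ∀ᶠ s in (U : Filter X), s ∈ S := hU self_mem_nhdsWithin
  obtain ⟨y, hy, hlim⟩ := (isCompact_sphere (0 : V) 1).ultrafilter_le_nhds (U.map v)
    (le_principal_iff.mpr <| hUS.mono fun s hs => by simpa using hv s hs)
  replace hlim : Tendsto v U (𝓝 y) := hlim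
  have hy_eig : T t y = μ t • y := by
    refine tendsto_nhds_unique ((isBoundedBilinearMap_apply.continuous.tendsto (T t, y)).comp
      (((hT.tendsto t).mono_left hUt).prodMk_nhds hlim))
      ((((hμ.tendsto t).mono_left hUt).smul hlim).congr' ?_)
    exact hUS.mono fun s hs => (heig s hs).symm
  have hvt : v t ≠ 0 := norm_ne_zero_iff.mp (by simp [hv t ht])
  obtain ⟨c, hc⟩ := (finrank_eq_one_iff_of_nonzero'
    (⟨v t, Module.End.mem_eigenspace_iff.mpr (heig t ht)⟩ :
      Module.End.eigenspace (T t : V →ₗ[ℂ] V) (μ t))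
    (by simpa [Subtype.ext_iff] using hvt)).mp hsimple ⟨y, Module.End.mem_eigenspace_iff.mpr hy_eig⟩
  replace hc : c • v t = y := congrArg Subtype.val hc
  have hcn : ‖c‖ = 1 := by
    have := congrArg norm hc
    rwa [norm_smul, hv t ht, mul_one, mem_sphere_zero_iff_norm.mp hy] at this
  rw [← hphase c hcn, hc]
  exact (hF.tendsto y).comp hlim

theorem euclNorm_eq_norm_toLp {K : Type*} [RCLike K] {I : Type*} [Fintype I] (x : I → K) :
    euclNorm x = ‖WithLp.toLp 2 x‖ := by
  rw [EuclideanSpace.norm_eq, euclNorm]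

theorem euclNorm_nonneg {K : Type*} [RCLike K] {I : Type*} [Fintype I] (x : I → K) :
    0 ≤ euclNorm x := Real.sqrt_nonneg _

theorem euclNorm_smul {K : Type*} [RCLike K] {I : Type*} [Fintype I] (c : K) (x : I → K) :
    euclNorm (c • x) = ‖c‖ * euclNorm x := by
  rw [euclNorm_eq_norm_toLp, euclNorm_eq_norm_toLp, WithLp.toLp_smul, norm_smul]

theorem norm_star_dotProduct_le {K : Type*} [RCLike K] {I : Type*} [Fintype I] (x y : I → K) :
    ‖star x ⬝ᵥ y‖ ≤ euclNorm x * euclNorm y := by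
  rw [euclNorm_eq_norm_toLp, euclNorm_eq_norm_toLp, dotProduct_comm]
  exact norm_inner_le_norm (𝕜 := K) (WithLp.toLp 2 x) (WithLp.toLp 2 y)

theorem euclNorm_mulVec_le {K : Type*} [RCLike K] {I J : Type*} [Fintype I] [Fintype J]
    [DecidableEq J] (M : Matrix I J K) (x : J → K) :
    euclNorm (M *ᵥ x) ≤ specNorm M * euclNorm x := by
  rw [euclNorm_eq_norm_toLp, euclNorm_eq_norm_toLp]
  exact (LinearMap.toContinuousLinearMap (Matrix.toEuclideanLin M)).le_opNorm (WithLp.toLp 2 x)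

theorem norm_star_dotProduct_mulVec_le {K : Type*} [RCLike K] {I J : Type*} [Fintype I]
    [Fintype J] [DecidableEq J] (M : Matrix I J K) (x : I → K) (y : J → K) :
    ‖star x ⬝ᵥ M *ᵥ y‖ ≤ specNorm M * euclNorm x * euclNorm y := by
  refine (norm_star_dotProduct_le _ _).trans ?_
  have := mul_le_mul_of_nonneg_left (euclNorm_mulVec_le M y) (euclNorm_nonneg x)
  linarith

theorem norm_star_dotProduct_conjTranspose_mulVec_le {K : Type*} [RCLike K] {I J : Type*}
    [Fintype I] [Fintype J] [DecidableEq J] (M : Matrix I J K) (x : J → K) (y : I → K) :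
    ‖star x ⬝ᵥ Mᴴ *ᵥ y‖ ≤ specNorm M * euclNorm x * euclNorm y := by
  rw [Matrix.dotProduct_mulVec, ← Matrix.star_mulVec]
  exact (norm_star_dotProduct_le _ _).trans
    (mul_le_mul_of_nonneg_right (euclNorm_mulVec_le M x) (euclNorm_nonneg y))

theorem norm_star_dotProduct_fromBlocks_mulVec_le {K : Type*} [RCLike K] {I J : Type*} [Fintype I]
    [Fintype J] [DecidableEq I] [DecidableEq J] (E₁₁ : Matrix I I K) (E₂₁ : Matrix J I K)
    (E₂₂ : Matrix J J K) (x₁ y₁ : I → K) (x₂ y₂ : J → K) :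
    ‖star (Sum.elim x₁ x₂) ⬝ᵥ fromBlocks E₁₁ E₂₁ᴴ E₂₁ E₂₂ *ᵥ Sum.elim y₁ y₂‖ ≤
      specNorm E₁₁ * euclNorm x₁ * euclNorm y₁
        + specNorm E₂₁ * (euclNorm x₁ * euclNorm y₂ + euclNorm x₂ * euclNorm y₁)
        + specNorm E₂₂ * euclNorm x₂ * euclNorm y₂ := by
  have hstar : star (Sum.elim x₁ x₂) = Sum.elim (star x₁) (star x₂) := by
    ext (_ | _) <;> rfl
  rw [fromBlocks_mulVec, hstar, sumElim_dotProduct_sumElim]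
  simp only [Sum.elim_comp_inl, Sum.elim_comp_inr, dotProduct_add]
  calc _ ≤ _ := norm_add_le_of_le (norm_add_le_of_le (norm_star_dotProduct_mulVec_le E₁₁ x₁ y₁)
          (norm_star_dotProduct_conjTranspose_mulVec_le E₂₁ x₁ y₂))
        (norm_add_le_of_le (norm_star_dotProduct_mulVec_le E₂₁ x₂ y₁)
          (norm_star_dotProduct_mulVec_le E₂₂ x₂ y₂))
    _ = _ := by ring

/-- Pairing the eigenvector equations of `A + s • E` and `A + t • E`. -/
theorem sub_mul_star_dotProduct_eigenvectors {I : Type*} [Fintype I] {A E : Matrix I I ℂ}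
    {s t a b : ℝ} (ht : (A + t • E).IsHermitian) {x y : I → ℂ}
    (hx : (A + t • E) *ᵥ x = (a : ℂ) • x) (hy : (A + s • E) *ᵥ y = (b : ℂ) • y) :
    ((b - a : ℝ) : ℂ) * (star x ⬝ᵥ y) = ((s - t : ℝ) : ℂ) * (star x ⬝ᵥ E *ᵥ y) := by
  have h₁ : star x ⬝ᵥ (A + t • E) *ᵥ y = (a : ℂ) * (star x ⬝ᵥ y) := by
    rw [Matrix.dotProduct_mulVec, ← ht.eq, ← Matrix.star_mulVec, hx, star_smul, smul_dotProduct]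
    simp
  have h₂ : (A + s • E) *ᵥ y = (A + t • E) *ᵥ y + ((s - t : ℝ) : ℂ) • (E *ᵥ y) := by
    simp only [add_mulVec, smul_mulVec]
    ext j
    simp
    ring
  have h₃ := congrArg (star x ⬝ᵥ ·) (h₂.symm.trans hy)
  simp only [dotProduct_add, dotProduct_smul, h₁, smul_eq_mul] at h₃
  push_cast at h₃ ⊢
  linear_combination -h₃

open Filter Topology Set in
/-- A continuous function whose difference quotients at `t` are dominated by functions tending
to `g t` varies by at most `∫ g`. -/
theorem abs_sub_le_integral_of_tendsto_bound {f g : ℝ → ℝ} {a b : ℝ} (hab : a ≤ b)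
    (hf : ContinuousOn f (Icc a b)) (hg : ContinuousOn g (Icc a b))
    {w G : ℝ → ℝ → ℝ} (hw : ∀ t ∈ Ico a b, Tendsto (w t) (𝓝[Icc a b] t) (𝓝 1))
    (hG : ∀ t ∈ Ico a b, Tendsto (G t) (𝓝[Icc a b] t) (𝓝 (g t)))
    (hbound : ∀ t ∈ Ico a b, ∀ s ∈ Icc a b, |f s - f t| * w t s ≤ |s - t| * G t s) :
    |f b - f a| ≤ ∫ t in a..b, g t := by
  have hint : IntervalIntegrable g MeasureTheory.volume a b :=
    (hg.mono (uIcc_of_le hab).le).intervalIntegrable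
  have hslope : ∀ t ∈ Ico a b, ∀ r, g t < r → ∀ᶠ s in 𝓝[>] t, |f s - f t| < r * (s - t) := by
    intro t ht r hr
    have hle : 𝓝[>] t ≤ 𝓝[Icc a b] t := by
      rw [← nhdsWithin_Ioc_eq_nhdsGT ht.2]
      exact nhdsWithin_mono _ fun s hs => ⟨ht.1.trans hs.1.le, hs.2⟩
    have hlim : Tendsto (fun s => G t s / w t s) (𝓝[>] t) (𝓝 (g t)) := by
      have := ((hG t ht).div (hw t ht) one_ne_zero).mono_left hle
      rwa [div_one] at this
    filter_upwards [hlim.eventually_lt_const hr, hle self_mem_nhdsWithin, self_mem_nhdsWithin,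
      hle ((hw t ht).eventually_const_lt one_pos)] with s hs hsI hst hpos
    have hst' : 0 < s - t := sub_pos.mpr hst
    have h := hbound t ht s hsI
    rw [abs_of_pos hst', ← le_div_iff₀ hpos, mul_div_assoc] at h
    exact h.trans_lt (by rw [mul_comm r]; gcongr)
  have key (h : ℝ → ℝ) (hh : ContinuousOn h (Icc a b))
      (hhf : ∀ s t, h s - h t ≤ |f s - f t|) : h b ≤ h a + ∫ t in a..b, g t := by
    refine image_le_of_liminf_slope_right_le_deriv_boundary (f := h) (B' := g)
      (B := fun u => h a + ∫ t in a..u, g t) hh (by simp) ?_ ?_ ?_ (right_mem_Icc.mpr hab)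
    · refine continuousOn_const.add ?_
      rw [← uIcc_of_le hab] at hg ⊢
      exact intervalIntegral.continuousOn_primitive_interval
        (hg.integrableOn_compact isCompact_uIcc)
    · intro t ht
      refine HasDerivWithinAt.const_add _ ?_
      have hIoi : Ioc t b ∈ 𝓝[>] t := Ioc_mem_nhdsGT ht.2
      refine intervalIntegral.integral_hasDerivWithinAt_right (t := Ioi t)
        (hint.mono_set (by
          rw [uIcc_of_le ht.1, uIcc_of_le hab]; exact Icc_subset_Icc_right ht.2.le)) ?_ ?_
      · exact ⟨Ioc t b, hIoi, (hg.mono fun s hs =>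
          ⟨ht.1.trans hs.1.le, hs.2⟩).aestronglyMeasurable measurableSet_Ioc⟩
      · refine (hg t ⟨ht.1, ht.2.le⟩).mono_of_mem_nhdsWithin ?_
        exact mem_of_superset hIoi fun s hs => ⟨ht.1.trans hs.1.le, hs.2⟩
    · intro t ht r hr
      refine Eventually.frequently ?_
      filter_upwards [hslope t ht r hr, self_mem_nhdsWithin] with s hs hst
      rw [slope_def_field, div_lt_iff₀ (sub_pos.mpr hst)]
      exact (hhf s t).trans_lt hs
  rw [abs_le]
  have h₁ := key f hf fun s t => le_abs_self _
  have h₂ := key (fun t => -f t) hf.neg fun s t => by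
    rw [abs_sub_comm]; exact le_trans (by linarith) (le_abs_self _)
  constructor <;> linarith

/-- Blockwise bound on the integrated eigenvalue perturbation. -/
theorem stmt_9 {m k : ℕ}
    (A11 : Matrix (Fin m) (Fin m) ℂ) (A21 : Matrix (Fin k) (Fin m) ℂ)
    (A22 : Matrix (Fin k) (Fin k) ℂ)
    (E11 : Matrix (Fin m) (Fin m) ℂ) (E21 : Matrix (Fin k) (Fin m) ℂ)
    (E22 : Matrix (Fin k) (Fin k) ℂ)
    (A : Matrix (Fin m ⊕ Fin k) (Fin m ⊕ Fin k) ℂ) (hAdef : A = fromBlocks A11 A21ᴴ A21 A22)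
    (E : Matrix (Fin m ⊕ Fin k) (Fin m ⊕ Fin k) ℂ) (hEdef : E = fromBlocks E11 E21ᴴ E21 E22)
    (hA : A.IsHermitian) (hE : E.IsHermitian) (hAE : (A + E).IsHermitian)
    (htE : ∀ t : ℝ, (A + t • E).IsHermitian)
    (i : Fin (Fintype.card (Fin m ⊕ Fin k)))
    (x1 : ℝ → (Fin m → ℂ)) (x2 : ℝ → (Fin k → ℂ))
    (heig : ∀ t ∈ Set.Icc (0:ℝ) 1,
      (A + t • E).mulVec (Sum.elim (x1 t) (x2 t))
        = ((ithEig (htE t) i : ℝ) : ℂ) • Sum.elim (x1 t) (x2 t))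
    (hunit : ∀ t ∈ Set.Icc (0:ℝ) 1, euclNorm (Sum.elim (x1 t) (x2 t)) = 1)
    (hsimple : ∀ t ∈ Set.Icc (0:ℝ) 1,
      Module.finrank ℂ (Module.End.eigenspace (Matrix.toEuclideanLin (A + t • E))
        ((ithEig (htE t) i : ℝ) : ℂ)) = 1) :
    |ithEig hAE i - ithEig hA i| ≤
      ∫ t in (0:ℝ)..1,
        (specNorm E11 * euclNorm (x1 t) ^ 2
          + 2 * specNorm E21 * euclNorm (x1 t) * euclNorm (x2 t)
          + specNorm E22 * euclNorm (x2 t) ^ 2) := by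
  set S : Set ℝ := Set.Icc 0 1
  set f : ℝ → ℝ := fun t => ithEig (htE t) i
  set x : ℝ → Fin m ⊕ Fin k → ℂ := fun t => Sum.elim (x1 t) (x2 t)
  have hM : Continuous fun t : ℝ => A + t • E := by fun_prop
  have hf : Continuous f := continuous_ithEig htE hM i
  have hlim {t : ℝ} (ht : t ∈ S) {F : (Fin m ⊕ Fin k → ℂ) → ℝ} (hF : Continuous F)
      (hphase : ∀ c : ℂ, ‖c‖ = 1 → ∀ y, F (c • y) = F y) :
      Filter.Tendsto (fun s => F (x s)) (nhdsWithin t S) (nhds (F (x t))) := by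
    refine tendsto_comp_eigenvector_of_simple ht
      (T := fun s => LinearMap.toContinuousLinearMap (Matrix.toEuclideanLin (A + s • E)))
      (μ := fun s => (f s : ℂ))
      (v := fun s => WithLp.toLp 2 (x s)) (F := fun y => F (WithLp.ofLp y)) ?_
      (Complex.continuous_ofReal.comp hf) ?_ ?_ (hsimple t ht)
      (hF.comp (PiLp.continuous_ofLp 2 _)) fun c hc => hphase c hc _
    · exact (LinearMap.continuous_of_finiteDimensional
        ((Matrix.toEuclideanLin (𝕜 := ℂ) (m := Fin m ⊕ Fin k) (n := Fin m ⊕ Fin k)).trans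
          LinearMap.toContinuousLinearMap).toLinearMap).comp hM
    · intro s hs
      exact congrArg (WithLp.toLp 2) (heig s hs)
    · intro s hs
      rw [← euclNorm_eq_norm_toLp]
      exact hunit s hs
  have hnorm_cont {I : Type} [Fintype I] : Continuous (euclNorm : (I → ℂ) → ℝ) := by
    unfold euclNorm; fun_prop
  have h1 {t : ℝ} (ht : t ∈ S) :
      Filter.Tendsto (fun s => euclNorm (x1 s)) (nhdsWithin t S) (nhds (euclNorm (x1 t))) :=
    hlim ht (F := fun y => euclNorm (y ∘ Sum.inl)) (hnorm_cont.comp (by fun_prop)) fun c hc y =>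
      (euclNorm_smul c (y ∘ Sum.inl)).trans (by rw [hc, one_mul])
  have h2 {t : ℝ} (ht : t ∈ S) :
      Filter.Tendsto (fun s => euclNorm (x2 s)) (nhdsWithin t S) (nhds (euclNorm (x2 t))) :=
    hlim ht (F := fun y => euclNorm (y ∘ Sum.inr)) (hnorm_cont.comp (by fun_prop)) fun c hc y =>
      (euclNorm_smul c (y ∘ Sum.inr)).trans (by rw [hc, one_mul])
  have hoverlap {t : ℝ} (ht : t ∈ S) :
      Filter.Tendsto (fun s => ‖star (x t) ⬝ᵥ x s‖) (nhdsWithin t S) (nhds 1) := by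
    have hself : ‖star (x t) ⬝ᵥ x t‖ = 1 := by
      have h := inner_self_eq_norm_sq_to_K (𝕜 := ℂ) (WithLp.toLp 2 (x t))
      rw [EuclideanSpace.inner_eq_star_dotProduct, ← euclNorm_eq_norm_toLp, hunit t ht,
        dotProduct_comm] at h
      simpa using congrArg norm h
    have h := hlim ht (F := fun y => ‖star (x t) ⬝ᵥ y‖)
      (continuous_const.dotProduct continuous_id).norm fun c hc y => by
        rw [dotProduct_smul, norm_smul, hc, one_mul]
    rwa [hself] at h
  have hA0 : ithEig hA i = f 0 := by simp [f]
  have hA1 : ithEig hAE i = f 1 := by simp [f]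
  rw [hA0, hA1]
  refine abs_sub_le_integral_of_tendsto_bound zero_le_one hf.continuousOn ?_
    (w := fun t s => ‖star (x t) ⬝ᵥ x s‖)
    (G := fun t s => specNorm E11 * euclNorm (x1 t) * euclNorm (x1 s)
      + specNorm E21 * (euclNorm (x1 t) * euclNorm (x2 s) + euclNorm (x2 t) * euclNorm (x1 s))
      + specNorm E22 * euclNorm (x2 t) * euclNorm (x2 s))
    (fun t ht => hoverlap (Set.Ico_subset_Icc_self ht)) (fun t ht => ?_) fun t ht s hs => ?_
  · intro t ht
    exact ((((h1 ht).pow 2).const_mul _).add (((h1 ht).const_mul _).mul (h2 ht))).add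
      (((h2 ht).pow 2).const_mul _)
  · have ht' := Set.Ico_subset_Icc_self ht
    convert (((h1 ht').const_mul _).add ((((h2 ht').const_mul _).add
      ((h1 ht').const_mul _)).const_mul _)).add ((h2 ht').const_mul _) using 2
    ring
  · have h := congrArg norm (sub_mul_star_dotProduct_eigenvectors (htE t)
      (heig t (Set.Ico_subset_Icc_self ht)) (heig s hs))
    rw [norm_mul, norm_mul, Complex.norm_real, Complex.norm_real, Real.norm_eq_abs,
      Real.norm_eq_abs] at h
    refine h.le.trans (mul_le_mul_of_nonneg_left ?_ (abs_nonneg _))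
    rw [hEdef]
    exact norm_star_dotProduct_fromBlocks_mulVec_le _ _ _ _ _ _ _
end
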